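/- Suppose for every b ∈ Y the map a ↦ ℓ(a,b) is σ-strongly convex and differentiable, and the marginal of (x,y) satisfies the loss setup with E[xxᵀ] = I. Let C_w = {w : ‖w‖ ≤ B_w}, let w* minimize L over C_w with L_w* = L(w*), assume ∇L(w*) = E[∂₁ℓ(w*ᵀx,y)·x], and let v ∈ ℝ^{d_z} with ‖v‖ ≤ B_v ≤ B_w. Define L_CCA(v) = E[ℓ((T_CCA(v))ᵀx, y)]. Then ‖w* − T_CCA(v)‖² = E[(w*ᵀx − (T_CCA(v))ᵀx)²] ≤ 2(L_CCA(v) − L_w*)/σ. -/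

import Mathlib

open MeasureTheory
open scoped RealInnerProductSpace

/-- The rectangular diagonal matrix of canonical correlations. -/
noncomputable def sigMat (dx dz : ℕ) (lam : ℕ → ℝ) : Matrix (Fin dx) (Fin dz) ℝ :=
  Matrix.of fun i j => if (i : ℕ) = (j : ℕ) then lam (i : ℕ) else 0

/-- The CCA transformation of a predictor on view `z` into a predictor on view `x`:
`T_CCA(v) = Ũ · [λ_i ṽ^i]_{i=1}^{d_x}` with `ṽ = Ṽᵀ v` and `ṽ^i := 0` for `i > d_z`. -/
noncomputable def Tcca {dx dz : ℕ} (U : Matrix (Fin dx) (Fin dx) ℝ)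
    (V : Matrix (Fin dz) (Fin dz) ℝ) (lam : ℕ → ℝ) (v : EuclideanSpace ℝ (Fin dz)) :
    EuclideanSpace ℝ (Fin dx) :=
  WithLp.toLp 2 <| U.mulVec fun i =>
    lam (i : ℕ) * (if h : (i : ℕ) < dz then V.transpose.mulVec v ⟨(i : ℕ), h⟩ else 0)

lemma mulVec_orth_sq {n : ℕ} (U : Matrix (Fin n) (Fin n) ℝ) (hU : U.transpose * U = 1)
    (a : Fin n → ℝ) : ∑ i, (U.mulVec a i) ^ 2 = ∑ i, a i ^ 2 := by
  have h : dotProduct (U.mulVec a) (U.mulVec a) = dotProduct a a := by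
    rw [Matrix.dotProduct_mulVec, ← Matrix.mulVec_transpose, Matrix.mulVec_mulVec, hU,
      Matrix.one_mulVec]
  simpa [dotProduct, pow_two] using h

lemma sum_ext_le {dx dz : ℕ} (f : Fin dz → ℝ) :
    ∑ i : Fin dx, (if h : (i : ℕ) < dz then f ⟨(i : ℕ), h⟩ else 0) ^ 2 ≤ ∑ j, f j ^ 2 := by
  let G : ℕ → ℝ := fun i => (if h : i < dz then f ⟨i, h⟩ else 0) ^ 2
  have hG : ∀ i, 0 ≤ G i := fun i => sq_nonneg _
  have h1 : ∑ i : Fin dx, (if h : (i : ℕ) < dz then f ⟨(i : ℕ), h⟩ else 0) ^ 2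
      = ∑ i ∈ Finset.range dx, G i := Fin.sum_univ_eq_sum_range G dx
  have h2 : ∑ j, f j ^ 2 = ∑ i ∈ Finset.range dz, G i := by
    rw [← Fin.sum_univ_eq_sum_range G dz]
    exact Finset.sum_congr rfl fun j _ => by simp [G]
  rw [h1, h2]
  have h3 : ∑ i ∈ Finset.range dx, G i = ∑ i ∈ (Finset.range dx).filter (· < dz), G i := by
    rw [Finset.sum_filter]
    refine Finset.sum_congr rfl fun i _ => ?_
    by_cases h : i < dz <;> simp [G, h]
  rw [h3]
  refine Finset.sum_le_sum_of_subset_of_nonneg ?_ fun i _ _ => hG i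
  intro i hi
  simp at hi ⊢
  exact hi.2

lemma Tcca_norm_le {dx dz : ℕ} (U : Matrix (Fin dx) (Fin dx) ℝ)
    (V : Matrix (Fin dz) (Fin dz) ℝ) (lam : ℕ → ℝ) (v : EuclideanSpace ℝ (Fin dz))
    (hU : U.transpose * U = 1) (hV : V.transpose * V = 1)
    (h0 : ∀ i, 0 ≤ lam i) (h1 : ∀ i, lam i ≤ 1) : ‖Tcca U V lam v‖ ≤ ‖v‖ := by
  have hV' : V.transpose.transpose * V.transpose = 1 := by
    rw [Matrix.transpose_transpose]; exact mul_eq_one_comm.mp hV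
  refine (sq_le_sq₀ (norm_nonneg _) (norm_nonneg _)).mp ?_
  rw [EuclideanSpace.real_norm_sq_eq, EuclideanSpace.real_norm_sq_eq]
  have e1 := mulVec_orth_sq U hU (fun i : Fin dx =>
    lam (i : ℕ) * (if h : (i : ℕ) < dz then V.transpose.mulVec v ⟨(i : ℕ), h⟩ else 0))
  have e2 := mulVec_orth_sq V.transpose hV' v
  have e3 := sum_ext_le (dx := dx) (V.transpose.mulVec v)
  calc ∑ i, (Tcca U V lam v) i ^ 2 = _ := e1
    _ ≤ ∑ i : Fin dx, (if h : (i : ℕ) < dz then V.transpose.mulVec v ⟨(i : ℕ), h⟩ else 0) ^ 2 := by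
      refine Finset.sum_le_sum fun i _ => ?_
      rw [mul_pow]
      refine mul_le_of_le_one_left (sq_nonneg _) ?_
      exact pow_le_one₀ (h0 _) (h1 _)
    _ ≤ _ := e3
    _ = _ := e2

lemma aemeas_dir {dx : ℕ} {Y : Type*} {Ωp : Type*} [MeasurableSpace Ωp] (μ : Measure Ωp)
    (X : Ωp → EuclideanSpace ℝ (Fin dx)) (lab : Ωp → Y) (ℓ : ℝ → Y → ℝ)
    (hℓ_diff : ∀ b, Differentiable ℝ fun a => ℓ a b)
    (hLint : ∀ w : EuclideanSpace ℝ (Fin dx),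
      Integrable (fun ω => ℓ (⟪w, X ω⟫) (lab ω)) μ)
    (w : EuclideanSpace ℝ (Fin dx)) (j : Fin dx) :
    AEMeasurable (fun ω => deriv (fun a => ℓ a (lab ω)) (⟪w, X ω⟫) * X ω j) μ := by
  let t : ℕ → ℝ := fun n => 1 / ((n : ℝ) + 1)
  refine aemeasurable_of_tendsto_metrizable_ae (u := Filter.atTop)
    (f := fun n ω => (t n)⁻¹ * (ℓ (⟪w + t n • EuclideanSpace.single j (1 : ℝ), X ω⟫) (lab ω)
      - ℓ (⟪w, X ω⟫) (lab ω))) ?_ ?_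
  · intro n
    exact (((hLint _).aemeasurable.sub (hLint _).aemeasurable).const_mul _)
  · refine Filter.Eventually.of_forall fun ω => ?_
    have ht : Filter.Tendsto t Filter.atTop (nhdsWithin 0 {0}ᶜ) := by
      refine tendsto_nhdsWithin_iff.mpr ⟨tendsto_one_div_add_atTop_nhds_zero_nat, ?_⟩
      exact Filter.Eventually.of_forall fun n => by
        have : (0 : ℝ) < t n := Nat.one_div_pos_of_nat
        simpa using this.ne'
    have hd : HasDerivAt (fun s : ℝ => ℓ (⟪w, X ω⟫ + s * X ω j) (lab ω))
        (deriv (fun a => ℓ a (lab ω)) (⟪w, X ω⟫) * X ω j) 0 := by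
      have hi : HasDerivAt (fun s : ℝ => ⟪w, X ω⟫ + s * X ω j) (X ω j) 0 := by
        simpa using ((hasDerivAt_id (0 : ℝ)).mul_const (X ω j)).const_add (⟪w, X ω⟫)
      have ho : HasDerivAt (fun a => ℓ a (lab ω)) (deriv (fun a => ℓ a (lab ω)) (⟪w, X ω⟫))
          (⟪w, X ω⟫ + 0 * X ω j) := by
        simpa using (hℓ_diff (lab ω) (⟪w, X ω⟫)).hasDerivAt
      exact ho.comp (0 : ℝ) hi
    have := (hasDerivAt_iff_tendsto_slope_zero.mp hd).comp ht
    refine this.congr fun n => ?_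
    simp [inner_add_left, inner_smul_left, EuclideanSpace.inner_single_left]

lemma aemeas_prod {dx : ℕ} {Y : Type*} {Ωp : Type*} [MeasurableSpace Ωp] (μ : Measure Ωp)
    (X : Ωp → EuclideanSpace ℝ (Fin dx)) (lab : Ωp → Y) (ℓ : ℝ → Y → ℝ) (σ : ℝ) (hσ : 0 < σ)
    (hℓ_diff : ∀ b, Differentiable ℝ fun a => ℓ a b)
    (hℓ_sc : ∀ b a₁ a₂,
      ℓ a₂ b + deriv (fun a => ℓ a b) a₂ * (a₁ - a₂) + σ / 2 * (a₁ - a₂) ^ 2 ≤ ℓ a₁ b)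
    (hLint : ∀ w : EuclideanSpace ℝ (Fin dx),
      Integrable (fun ω => ℓ (⟪w, X ω⟫) (lab ω)) μ)
    (i j : Fin dx) (hi : AEMeasurable (fun ω => X ω i * X ω i) μ) :
    AEMeasurable (fun ω => X ω i * X ω j) μ := by
  have hm := fun k => (aemeas_dir μ X lab ℓ hℓ_diff hLint (EuclideanSpace.single i 1) k).sub
    (aemeas_dir μ X lab ℓ hℓ_diff hLint 0 k)
  refine (hi.mul ((hm j).div (hm i))).congr (Filter.Eventually.of_forall fun ω => ?_)
  have e : ⟪(EuclideanSpace.single i (1 : ℝ)), X ω⟫ = X ω i := by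
    simp [EuclideanSpace.inner_single_left]
  simp only [Pi.mul_apply, Pi.div_apply, Pi.sub_apply, e, inner_zero_left, ← sub_mul]
  by_cases h : X ω i = 0
  · simp [h]
  · have h1 := hℓ_sc (lab ω) (X ω i) 0
    have h2 := hℓ_sc (lab ω) 0 (X ω i)
    have hp : 0 < σ * (X ω i) ^ 2 := by positivity
    have hc : deriv (fun a => ℓ a (lab ω)) (X ω i) - deriv (fun a => ℓ a (lab ω)) 0 ≠ 0 := by
      intro h0
      have h0' := sub_eq_zero.mp h0
      rw [h0'] at h2
      nlinarith
    field_simp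

lemma second_moment {dx : ℕ} {Ωp : Type*} [MeasurableSpace Ωp] (μ : Measure Ωp)
    (X : Ωp → EuclideanSpace ℝ (Fin dx))
    (hXcov : ∀ i j, ∫ ω, X ω i * X ω j ∂μ = if i = j then (1 : ℝ) else 0)
    (hm : ∀ i j, AEMeasurable (fun ω => X ω i * X ω i) μ →
      AEMeasurable (fun ω => X ω i * X ω j) μ) (d : EuclideanSpace ℝ (Fin dx)) :
    ‖d‖ ^ 2 = ∫ ω, ⟪d, X ω⟫ ^ 2 ∂μ := by
  have hii : ∀ i, Integrable (fun ω => X ω i * X ω i) μ := fun i => by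
    by_contra h
    have := hXcov i i
    rw [integral_undef h] at this
    simp at this
  have hij : ∀ i j, Integrable (fun ω => X ω i * X ω j) μ := fun i j => by
    refine ((hii i).add (hii j)).mono' (hm i j (hii i).aemeasurable).aestronglyMeasurable ?_
    refine Filter.Eventually.of_forall fun ω => ?_
    simp only [Pi.add_apply, Real.norm_eq_abs]
    rw [abs_le]
    constructor <;> nlinarith [sq_nonneg (X ω i + X ω j), sq_nonneg (X ω i - X ω j),
      sq_nonneg (X ω i), sq_nonneg (X ω j)]
  have e : ∀ ω, ⟪d, X ω⟫ ^ 2 = ∑ i, ∑ j, (d i * d j) * (X ω i * X ω j) := fun ω => by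
    rw [PiLp.inner_apply, pow_two, Finset.sum_mul_sum]
    refine Finset.sum_congr rfl fun i _ => Finset.sum_congr rfl fun j _ => ?_
    simp
    ring
  simp_rw [e]
  rw [integral_finsetSum _ fun i _ => integrable_finsetSum _ fun j _ => (hij i j).const_mul _]
  simp_rw [integral_finsetSum _ fun j _ => (hij _ j).const_mul _, integral_const_mul, hXcov]
  rw [EuclideanSpace.real_norm_sq_eq]
  simp [pow_two]

theorem stmt7
    {dx dz : ℕ} {Y : Type*} [MeasurableSpace Y]
    {Ωp : Type*} [MeasurableSpace Ωp] (μ : Measure Ωp) [IsProbabilityMeasure μ]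
    (X : Ωp → EuclideanSpace ℝ (Fin dx)) (Z : Ωp → EuclideanSpace ℝ (Fin dz))
    (lab : Ωp → Y)
    (ℓ : ℝ → Y → ℝ) (σ : ℝ) (hσ : 0 < σ)
    (hℓ_nonneg : ∀ a b, 0 ≤ ℓ a b)
    (hℓ_diff : ∀ b, Differentiable ℝ fun a => ℓ a b)
    (hℓ_sc : ∀ b a₁ a₂,
      ℓ a₂ b + deriv (fun a => ℓ a b) a₂ * (a₁ - a₂) + σ / 2 * (a₁ - a₂) ^ 2 ≤ ℓ a₁ b)
    -- CCA setup
    (U : Matrix (Fin dx) (Fin dx) ℝ) (V : Matrix (Fin dz) (Fin dz) ℝ) (lam : ℕ → ℝ)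
    (hU : U.transpose * U = 1) (hV : V.transpose * V = 1)
    (hlam_le_one : lam 0 ≤ 1) (hlam_nonneg : ∀ i, 0 ≤ lam i)
    (hlam_mono : ∀ i j, i ≤ j → lam j ≤ lam i)
    (hXmean : ∀ i, ∫ ω, X ω i ∂μ = 0) (hZmean : ∀ j, ∫ ω, Z ω j ∂μ = 0)
    (hXcov : ∀ i j, ∫ ω, X ω i * X ω j ∂μ = if i = j then (1 : ℝ) else 0)
    (hZcov : ∀ i j, ∫ ω, Z ω i * Z ω j ∂μ = if i = j then (1 : ℝ) else 0)
    (hXZcov : ∀ i j, ∫ ω, X ω i * Z ω j ∂μ = (U * sigMat dx dz lam * V.transpose) i j)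
    -- expected loss
    (L : EuclideanSpace ℝ (Fin dx) → ℝ)
    (hL : ∀ w, L w = ∫ ω, ℓ (⟪w, X ω⟫) (lab ω) ∂μ)
    (hLint : ∀ w : EuclideanSpace ℝ (Fin dx),
      Integrable (fun ω => ℓ (⟪w, X ω⟫) (lab ω)) μ)
    -- the minimizer of L over the ball of radius B_w
    (Bw Bv : ℝ) (hBvw : Bv ≤ Bw)
    (wstar : EuclideanSpace ℝ (Fin dx)) (hws_mem : ‖wstar‖ ≤ Bw)
    (hws_min : ∀ w : EuclideanSpace ℝ (Fin dx), ‖w‖ ≤ Bw → L wstar ≤ L w)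
    -- the gradient of L at w* is obtained by differentiating under the integral
    (g : EuclideanSpace ℝ (Fin dx))
    (hg : g = fun j => ∫ ω, deriv (fun a => ℓ a (lab ω)) (⟪wstar, X ω⟫) * X ω j ∂μ)
    (hgrad : HasGradientAt L g wstar)
    -- the teacher predictor
    (v : EuclideanSpace ℝ (Fin dz)) (hv_mem : ‖v‖ ≤ Bv)
    (hsqint : Integrable
      (fun ω => (⟪wstar, X ω⟫ - ⟪Tcca U V lam v, X ω⟫) ^ 2) μ) :
    ‖wstar - Tcca U V lam v‖ ^ 2
        = (∫ ω, (⟪wstar, X ω⟫ - ⟪Tcca U V lam v, X ω⟫) ^ 2 ∂μ) ∧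
    (∫ ω, (⟪wstar, X ω⟫ - ⟪Tcca U V lam v, X ω⟫) ^ 2 ∂μ)
        ≤ 2 * (L (Tcca U V lam v) - L wstar) / σ := by
  have hT : ‖Tcca U V lam v‖ ≤ Bw :=
    (Tcca_norm_le U V lam v hU hV hlam_nonneg
      fun i => (hlam_mono 0 i (Nat.zero_le _)).trans hlam_le_one).trans (hv_mem.trans hBvw)
  constructor
  · rw [second_moment μ X hXcov (fun i j => aemeas_prod μ X lab ℓ σ hσ hℓ_diff hℓ_sc hLint i j)]
    simp_rw [inner_sub_left]
  generalize Tcca U V lam v = T at *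
  set Q := ∫ ω, (⟪wstar, X ω⟫ - ⟪T, X ω⟫) ^ 2 ∂μ with hQ
  have key : ∀ t : ℝ, 0 < t → t < 1 → σ / 2 * (1 - t) * Q ≤ L T - L wstar := by
    intro t ht0 ht1
    have hmem : ‖(1 - t) • wstar + t • T‖ ≤ Bw := by
      have hc := convex_closedBall (0 : EuclideanSpace ℝ (Fin dx)) Bw
      have := hc (mem_closedBall_zero_iff.mpr hws_mem) (mem_closedBall_zero_iff.mpr hT)
        (by linarith : 0 ≤ 1 - t) ht0.le (by ring)
      exact mem_closedBall_zero_iff.mp this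
    have h1 := hws_min _ hmem
    have h2 : L ((1 - t) • wstar + t • T) + σ / 2 * (t * (1 - t)) * Q
        ≤ (1 - t) * L wstar + t * L T := by
      rw [hL, hL wstar, hL T, hQ, ← integral_const_mul, ← integral_const_mul,
        ← integral_const_mul, ← integral_add (hLint _) (hsqint.const_mul _),
        ← integral_add ((hLint _).const_mul _) ((hLint _).const_mul _)]
      refine integral_mono ((hLint _).add (hsqint.const_mul _))
        (((hLint _).const_mul _).add ((hLint _).const_mul _)) fun ω => ?_
      simp only [inner_add_left, real_inner_smul_left]
      generalize ⟪wstar, X ω⟫ = a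
      generalize ⟪T, X ω⟫ = b
      have ha := hℓ_sc (lab ω) a ((1 - t) * a + t * b)
      have hb := hℓ_sc (lab ω) b ((1 - t) * a + t * b)
      have ha' := mul_le_mul_of_nonneg_left ha (by linarith : 0 ≤ 1 - t)
      have hb' := mul_le_mul_of_nonneg_left hb ht0.le
      linarith
    have h3 : t * (σ / 2 * (1 - t) * Q) ≤ t * (L T - L wstar) := by linarith
    exact le_of_mul_le_mul_left h3 ht0
  have hlim : σ / 2 * Q ≤ L T - L wstar := by
    have hc : Filter.Tendsto (fun t : ℝ => σ / 2 * (1 - t) * Q) (nhdsWithin 0 (Set.Ioi 0))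
        (nhds (σ / 2 * Q)) := by
      have : Continuous (fun t : ℝ => σ / 2 * (1 - t) * Q) := by fun_prop
      simpa using (this.tendsto 0).mono_left nhdsWithin_le_nhds
    refine le_of_tendsto hc ?_
    filter_upwards [Ioo_mem_nhdsGT (zero_lt_one : (0 : ℝ) < 1)] with t ht
    exact key t ht.1 ht.2
  rw [le_div_iff₀ hσ]
  linarith
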